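/- arXiv:1512.05881 — 3 statements merged into one kernel-verified Lean document; each statement's English description precedes it below -/
import Mathlib

section
/- Let β ≥ 1, m ≥ 1, and s be natural numbers, let Γ be an alphabet with β letters, and let k be a natural number with k < s. The number of s-tuples (w₁, …, w_s) of words over Γ with total length |w₁| + ⋯ + |w_s| = m such that exactly k of the components wᵢ are the empty word equals C(s,k) · β^m · C(m−1, s−k−1). (In the automaton interpretation, this counts the labelings of s transitions with total output size m having exactly k pop transitions.) -/
/-- Functions of sum `n` whose support is exactly `Z` correspond to compositions of `n`
into `#Z` positive parts. -/
theorem card_filter_piAntidiag_ne_zero {ι : Type*} [DecidableEq ι] (Z : Finset ι) (n : ℕ)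
    (hn : 1 ≤ n) (hZ : 1 ≤ Z.card) :
    ((Z.piAntidiag n).filter fun l : ι → ℕ => ∀ i ∈ Z, l i ≠ 0).card =
      (n - 1).choose (Z.card - 1) := by
  rcases lt_or_ge n Z.card with h | h
  · rw [Nat.choose_eq_zero_of_lt (by omega), Finset.card_eq_zero,
      Finset.filter_eq_empty_iff]
    intro l hl hpos
    have hsum : ∑ i ∈ Z, l i = n := (Finset.mem_piAntidiag.1 hl).1
    have : ∑ _i ∈ Z, 1 ≤ ∑ i ∈ Z, l i :=
      Finset.sum_le_sum fun i hi => Nat.one_le_iff_ne_zero.2 (hpos i hi)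
    simp at this
    omega
  · have hcard : (Z.piAntidiag (n - Z.card)).card = (n - 1).choose (Z.card - 1) := by
      have h1 := Finset.card_finsuppAntidiag_nat_eq_choose (s := Z) (n - Z.card)
      rw [Finset.finsuppAntidiag, Finset.card_map, Finset.card_attach] at h1
      rw [h1, show Z.card + (n - Z.card) - 1 = n - 1 by omega]
      exact Nat.choose_symm_of_eq_add (by omega)
    rw [← hcard]
    refine Finset.card_bij' (fun l _ i => l i - 1) (fun l _ i => if i ∈ Z then l i + 1 else 0)
      ?_ ?_ ?_ ?_
    · intro l hl
      simp only [Finset.mem_filter, Finset.mem_piAntidiag] at hl ⊢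
      refine ⟨?_, fun i hi => hl.1.2 i (by omega)⟩
      rw [Finset.sum_tsub_distrib Z fun i hi => Nat.one_le_iff_ne_zero.2 (hl.2 i hi)]
      simp [hl.1.1]
    · intro l hl
      simp only [Finset.mem_filter, Finset.mem_piAntidiag] at hl ⊢
      refine ⟨⟨?_, fun i hi => by by_contra h'; simp [h'] at hi⟩, fun i hi => by simp [hi]⟩
      rw [Finset.sum_congr rfl fun i hi => if_pos hi, Finset.sum_add_distrib, hl.1]
      simp [h]
    · intro l hl
      simp only [Finset.mem_filter, Finset.mem_piAntidiag] at hl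
      funext i
      by_cases hi : i ∈ Z
      · have := hl.2 i hi
        simp only [hi, if_true]
        omega
      · have : l i = 0 := by by_contra h'; exact hi (hl.1.2 i h')
        simp [hi, this]
    · intro l hl
      simp only [Finset.mem_piAntidiag] at hl
      funext i
      by_cases hi : i ∈ Z
      · simp [hi]
      · have : l i = 0 := by by_contra h'; exact hi (hl.2 i h')
        simp [hi, this]

theorem card_filter_piAntidiag_card_eq_zero (m s k : ℕ) (hm : 1 ≤ m) (hk : k < s) :
    (((Finset.univ : Finset (Fin s)).piAntidiag m).filter fun l : Fin s → ℕ =>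
        (Finset.univ.filter fun i => l i = 0).card = k).card =
      s.choose k * (m - 1).choose (s - k - 1) := by
  have hmaps : ∀ l ∈ ((Finset.univ : Finset (Fin s)).piAntidiag m).filter
      (fun l : Fin s → ℕ => (Finset.univ.filter fun i => l i = 0).card = k),
      (Finset.univ.filter fun i => l i = 0) ∈
        Finset.powersetCard k (Finset.univ : Finset (Fin s)) := by
    intro l hl
    simpa [Finset.mem_powersetCard] using (Finset.mem_filter.1 hl).2
  rw [Finset.card_eq_sum_card_fiberwise hmaps,
    Finset.sum_const_nat (m := (m - 1).choose (s - k - 1)), Finset.card_powersetCard,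
    Finset.card_univ, Fintype.card_fin]
  intro Z hZ
  have hZk : Z.card = k := (Finset.mem_powersetCard.1 hZ).2
  have hc : Zᶜ.card = s - k := by rw [Finset.card_compl, hZk, Fintype.card_fin]
  rw [← hc, ← card_filter_piAntidiag_ne_zero Zᶜ m hm (by omega)]
  congr 1
  ext l
  simp only [Finset.mem_filter, Finset.mem_piAntidiag, Finset.mem_compl]
  constructor
  · rintro ⟨⟨⟨hs, -⟩, -⟩, rfl⟩
    refine ⟨⟨?_, by simp⟩, by simp⟩
    rw [← hs]
    exact Finset.sum_subset (Finset.subset_univ _) (by simp)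
  · rintro ⟨⟨hs, h1⟩, h2⟩
    have hzero : (Finset.univ.filter fun i => l i = 0) = Z := by
      ext i
      simp only [Finset.mem_filter, Finset.mem_univ, true_and]
      exact ⟨fun h => by_contra fun h' => h2 i h' h, fun h => by_contra fun h' => h1 i h' h⟩
    refine ⟨⟨⟨?_, by simp⟩, by rw [hzero, hZk]⟩, hzero⟩
    rw [← hs]
    refine (Finset.sum_subset (Finset.subset_univ _) fun i _ hi => ?_).symm
    exact by_contra fun h' => hi (Finset.mem_compl.2 (h1 i h'))

/-- Tuples of words whose length profile lies in `L` are pairs of a profile in `L` and a tuple of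
vectors of the prescribed lengths. -/
def wordTupleEquivSigma {ι α : Type*} (L : Finset (ι → ℕ)) :
    {f : ι → List α // (fun i => (f i).length) ∈ L} ≃
      Σ l : L, ∀ i, List.Vector α (l.1 i) where
  toFun f := ⟨⟨fun i => (f.1 i).length, f.2⟩, fun i => ⟨f.1 i, rfl⟩⟩
  invFun p := ⟨fun i => (p.2 i).1, by
    have : (fun i => (p.2 i).1.length) = p.1.1 := funext fun i => (p.2 i).2
    rw [this]
    exact p.1.2⟩
  left_inv _ := rfl
  right_inv := by
    rintro ⟨⟨l, hl⟩, v⟩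
    obtain ⟨w, hw, rfl⟩ : ∃ (w : ι → List α) (hw : ∀ i, (w i).length = l i),
        v = fun i => ⟨w i, hw i⟩ := ⟨fun i => (v i).1, fun i => (v i).2, rfl⟩
    obtain rfl : (fun i => (w i).length) = l := funext hw
    rfl

/-- The number of `s`-tuples of words over a `β`-letter alphabet with total
length `m` and exactly `k` empty components equals
`C(s,k) * β^m * C(m-1, s-k-1)`. -/
theorem stmt_2 (β m s k : ℕ) (hβ : 1 ≤ β) (hm : 1 ≤ m) (hk : k < s) :
    Nat.card {f : Fin s → List (Fin β) //
        (∑ i, (f i).length = m) ∧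
        (Finset.univ.filter fun i => f i = []).card = k} =
      Nat.choose s k * β ^ m * Nat.choose (m - 1) (s - k - 1) := by
  set L := ((Finset.univ : Finset (Fin s)).piAntidiag m).filter fun l : Fin s → ℕ =>
    (Finset.univ.filter fun i => l i = 0).card = k with hL
  have e : {f : Fin s → List (Fin β) // (∑ i, (f i).length = m) ∧
      (Finset.univ.filter fun i => f i = []).card = k} ≃
      {f : Fin s → List (Fin β) // (fun i => (f i).length) ∈ L} :=
    Equiv.subtypeEquivRight fun f => by
      simp [hL, Finset.mem_piAntidiag, List.length_eq_zero_iff]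
  rw [Nat.card_congr (e.trans (wordTupleEquivSigma L)), Nat.card_eq_fintype_card,
    Fintype.card_sigma]
  have hfib : ∀ l : L, Fintype.card (∀ i, List.Vector (Fin β) (l.1 i)) = β ^ m := by
    intro l
    have hs := (Finset.mem_piAntidiag.1 (Finset.mem_filter.1 l.2).1).1
    simp [Fintype.card_pi, card_vector, Finset.prod_pow_eq_pow_sum, hs]
  rw [Finset.sum_congr rfl fun l _ => hfib l, Finset.sum_const, Finset.card_univ,
    Fintype.card_coe, hL, card_filter_piAntidiag_card_eq_zero m s k hm hk, smul_eq_mul]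
  ring
end

section
/- Let β ≥ 1, s ≥ 2 and m ≥ 0 be natural numbers, and let Γ be an alphabet with β letters. Summing, over all s-tuples (w₁, …, w_s) of words over Γ with total length |w₁| + ⋯ + |w_s| = m, the number of indices i with wᵢ equal to the empty word, gives (s+m−1) · (that sum) = s·(s−1) · β^m · C(s+m−1, m). Equivalently, since the number of such tuples is β^m · C(s+m−1, m), the average number of empty components over the uniform distribution on these tuples is s(s−1)/(s+m−1). (This is the average number of pop transitions of a real-time deterministic pushdown automaton with s transitions and output size m.) -/
/-- The finite set of words of length `n` over a finite alphabet `α`. -/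
noncomputable def wordsOfLength (α : Type*) [Finite α] (n : ℕ) : Finset (List α) :=
  (List.finite_length_eq α n).toFinset

theorem mem_wordsOfLength {α : Type*} [Finite α] {n : ℕ} {l : List α} :
    l ∈ wordsOfLength α n ↔ l.length = n := by
  simp [wordsOfLength]

theorem card_wordsOfLength (α : Type*) [Fintype α] (n : ℕ) :
    (wordsOfLength α n).card = Fintype.card α ^ n := by
  rw [← card_vector n, ← Fintype.card_coe]
  exact Fintype.card_congr (Equiv.subtypeEquivRight fun _ => mem_wordsOfLength)

open Classical in
/-- The finite set of `k`-tuples of words over `α` with total length `m`. -/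
noncomputable def wordTuples (α : Type*) [Finite α] (k m : ℕ) : Finset (Fin k → List α) :=
  (Finset.finAntidiagonal k m).biUnion fun g => Fintype.piFinset fun i => wordsOfLength α (g i)

theorem mem_wordTuples {α : Type*} [Finite α] {k m : ℕ} {f : Fin k → List α} :
    f ∈ wordTuples α k m ↔ ∑ i, (f i).length = m := by
  simp only [wordTuples, Finset.mem_biUnion, Finset.mem_finAntidiagonal, Fintype.mem_piFinset,
    mem_wordsOfLength]
  constructor
  · rintro ⟨g, hg, hf⟩
    simpa only [hf] using hg
  · exact fun hf => ⟨fun i => (f i).length, hf, fun _ => rfl⟩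

theorem card_finAntidiagonal_nat (k m : ℕ) :
    (Finset.finAntidiagonal k m).card = (k + m - 1).choose m := by
  have h := Sym.card_sym_eq_choose (α := Fin k) m
  rw [Fintype.card_fin] at h
  rw [← h, ← Fintype.card_coe]
  exact Fintype.card_congr ((Equiv.subtypeEquivRight fun _ => Finset.mem_finAntidiagonal).trans
    (Sym.equivNatSumOfFintype (Fin k) m).symm)

theorem card_wordTuples (α : Type*) [Fintype α] (k m : ℕ) :
    (wordTuples α k m).card = (k + m - 1).choose m * Fintype.card α ^ m := by
  classical
  rw [wordTuples, Finset.card_biUnion]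
  · rw [← card_finAntidiagonal_nat, ← smul_eq_mul]
    refine Finset.sum_eq_card_nsmul fun g hg => ?_
    rw [Fintype.card_piFinset]
    simp only [card_wordsOfLength]
    rw [Finset.prod_pow_eq_pow_sum, Finset.mem_finAntidiagonal.1 hg]
  · intro g _ g' _ hne
    rw [Function.onFun, Finset.disjoint_left]
    intro f hf hf'
    simp only [Fintype.mem_piFinset, mem_wordsOfLength] at hf hf'
    exact hne (funext fun i => (hf i).symm.trans (hf' i))

theorem card_filter_wordTuples_eq_nil (α : Type*) [Finite α] [DecidableEq α] (k m : ℕ)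
    (i : Fin (k + 1)) :
    ((wordTuples α (k + 1) m).filter fun f => f i = []).card = (wordTuples α k m).card := by
  refine Finset.card_nbij' (fun f => i.removeNth f)
    (fun f => i.insertNth (α := fun _ => List α) [] f) ?_ ?_ ?_ ?_
  · intro f hf
    simp only [Finset.coe_filter, Set.mem_ofPred_eq, mem_wordTuples, Finset.mem_coe,
      Fin.sum_univ_succAbove _ i] at hf ⊢
    simpa [hf.2, Fin.removeNth] using hf.1
  · intro f hf
    simp only [Finset.coe_filter, Set.mem_ofPred_eq, mem_wordTuples, Finset.mem_coe,
      Fin.sum_univ_succAbove _ i] at hf ⊢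
    simpa using hf
  · intro f hf
    have h : f i = [] := (Finset.mem_filter.1 hf).2
    simp only [← h]
    exact Fin.insertNth_self_removeNth i f
  · intro f _
    simp

theorem sum_wordTuples_card_eq_nil (α : Type*) [Fintype α] [DecidableEq α] (k m : ℕ) :
    ∑ f ∈ wordTuples α (k + 1) m, (Finset.univ.filter fun i => f i = []).card =
      (k + 1) * ((k + m - 1).choose m * Fintype.card α ^ m) := by
  simp_rw [Finset.card_filter]
  rw [Finset.sum_comm]
  simp_rw [← Finset.card_filter, card_filter_wordTuples_eq_nil, card_wordTuples]
  simp

/-- Summing the number of empty components (pop transitions) over all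
`s`-tuples of words over a `β`-letter alphabet with total length `m`:
`(s+m-1) * (sum) = s*(s-1) * β^m * C(s+m-1, m)`, i.e. the average number of
pop transitions is `s(s-1)/(s+m-1)`. -/
theorem stmt_3 (β s m : ℕ) (hβ : 1 ≤ β) (hs : 2 ≤ s) :
    (s + m - 1) *
      (∑ᶠ f ∈ {f : Fin s → List (Fin β) | ∑ i, (f i).length = m},
        (Finset.univ.filter fun i => f i = []).card) =
      s * (s - 1) * β ^ m * Nat.choose (s + m - 1) m := by
  obtain ⟨t, rfl⟩ := Nat.exists_eq_add_of_le' hs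
  have hset : {f : Fin (t + 2) → List (Fin β) | ∑ i, (f i).length = m} =
      ↑(wordTuples (Fin β) (t + 2) m) := by
    ext f
    simp [mem_wordTuples]
  have hchoose : (t + m + 1) * (t + m).choose m = (t + m + 1).choose m * (t + 1) := by
    have h := Nat.add_one_mul_choose_eq (t + m) t
    rwa [Nat.choose_symm_add, Nat.choose_symm_of_eq_add (show t + m + 1 = t + 1 + m by ring)] at h
  rw [hset, finsum_mem_coe_finset, sum_wordTuples_card_eq_nil, Fintype.card_fin,
    show t + 2 + m - 1 = t + m + 1 by omega, show t + 1 + m - 1 = t + m by omega,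
    show t + 2 - 1 = t + 1 by omega]
  linear_combination (t + 2) * β ^ m * hchoose
end

section
/- Let p and q be positive integers and set λ = p/q (a positive rational). Then, as t → ∞ over the natural numbers, C((p+q)·t − 1, p·t) is asymptotically equivalent to (λ+1)^{(λ+1)·q·t − 1/2} / (λ^{λ·q·t + 1/2} · √(2π·q·t)); that is, the ratio C((p+q)t − 1, pt) · λ^{pt + 1/2} · √(2π q t) / (λ+1)^{(p+q)t − 1/2} tends to 1. (With s = qt transitions and output size m = pt = λs over a β-letter stack alphabet, this gives the asymptotics [z^{λs}]F_s(z) = β^{λs}·C(s+m−1, m) ∼ (λ+1)^{(λ+1)s−1/2} β^{λs} / (λ^{λs+1/2} √(2πs)) used to enumerate complete accessible real-time deterministic pushdown automata.) -/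
open Real Filter

/-- The binomial coefficient `C(a+b-1, a)`, normalized by its asymptotic main term, is a ratio of
Stirling sequences. -/
theorem choose_mul_rpow_div_eq_stirlingSeq (a b : ℕ) (ha : 0 < a) (hb : 0 < b) :
    (Nat.choose (a + b - 1) a : ℝ) * ((a : ℝ) / b) ^ ((a : ℝ) + 1 / 2) *
        Real.sqrt (2 * Real.pi * b) / ((a : ℝ) / b + 1) ^ (((a + b : ℕ) : ℝ) - 1 / 2) =
      Real.sqrt Real.pi * Stirling.stirlingSeq (a + b) /
        (Stirling.stirlingSeq a * Stirling.stirlingSeq b) := by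
  have ha' : (0 : ℝ) < a := by exact_mod_cast ha
  have hb' : (0 : ℝ) < b := by exact_mod_cast hb
  have hab : (0 : ℝ) < (a : ℝ) + b := by positivity
  have hchoose : (Nat.choose (a + b - 1) a : ℝ) =
      b / (a + b) * ((a + b).factorial / (a.factorial * b.factorial)) := by
    obtain ⟨c, rfl⟩ : ∃ c, b = c + 1 := ⟨b - 1, by omega⟩
    rw [show a + (c + 1) - 1 = a + c by omega, Nat.cast_add_choose, ← add_assoc,
      Nat.factorial_succ, Nat.factorial_succ]
    push_cast at hab ⊢
    have h₁ : (a : ℝ) + c + 1 ≠ 0 := by positivity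
    have h₂ : (a : ℝ) + (c + 1) ≠ 0 := by positivity
    field_simp
    ring
  have hsum : (a : ℝ) / b + 1 = (a + b) / b := by field_simp
  rw [hchoose, hsum, Real.rpow_add (by positivity), Real.rpow_sub (by positivity),
    Real.rpow_natCast, Real.rpow_natCast, ← Real.sqrt_eq_rpow, ← Real.sqrt_eq_rpow,
    Real.sqrt_div ha'.le, Real.sqrt_div hab.le, Real.sqrt_mul (by positivity),
    Real.sqrt_mul (by positivity)]
  simp only [Stirling.stirlingSeq]
  push_cast
  rw [Real.sqrt_mul (by positivity), Real.sqrt_mul (by positivity), Real.sqrt_mul (by positivity)]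
  have hB := Real.sq_sqrt hb'.le
  have hN := Real.sq_sqrt hab.le
  have hT : Real.sqrt 2 ≠ 0 := by positivity
  have hA0 : Real.sqrt a ≠ 0 := by positivity
  have hB0 : Real.sqrt b ≠ 0 := by positivity
  have hN0 : Real.sqrt ((a : ℝ) + b) ≠ 0 := by positivity
  have hfa : (a.factorial : ℝ) ≠ 0 := by positivity
  have hfb : (b.factorial : ℝ) ≠ 0 := by positivity
  simp only [div_pow, pow_add]
  generalize Real.sqrt 2 = T at *
  generalize Real.sqrt (a : ℝ) = A at *
  generalize Real.sqrt (b : ℝ) = B at *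
  generalize Real.sqrt ((a : ℝ) + b) = N at *
  field_simp
  rw [← hN, ← hB]
  field_simp

/-- Saddle-point asymptotics for the central coefficient: with `λ = p/q > 0`,
`C((p+q)t - 1, pt) ∼ (λ+1)^((λ+1)qt - 1/2) / (λ^(λqt + 1/2) √(2π q t))`
as `t → ∞`, stated as the corresponding ratio tending to `1`. -/
theorem stmt_7 (p q : ℕ) (hp : 0 < p) (hq : 0 < q) :
    Filter.Tendsto (fun t : ℕ =>
        (Nat.choose ((p + q) * t - 1) (p * t) : ℝ) *
            ((p : ℝ) / q) ^ (((p * t : ℕ) : ℝ) + 1 / 2) *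
            Real.sqrt (2 * Real.pi * q * t) /
          ((p : ℝ) / q + 1) ^ ((((p + q) * t : ℕ) : ℝ) - 1 / 2))
      Filter.atTop (nhds 1) := by
  have hlim (k : ℕ) (hk : 0 < k) :
      Tendsto (fun t : ℕ => Stirling.stirlingSeq (k * t)) atTop (nhds (Real.sqrt Real.pi)) :=
    Stirling.tendsto_stirlingSeq_sqrt_pi.comp (tendsto_id.const_mul_atTop' hk)
  have hpi : Real.sqrt Real.pi ≠ 0 := by positivity
  have key := ((hlim (p + q) (by omega)).const_mul (Real.sqrt Real.pi)).div
    ((hlim p hp).mul (hlim q hq)) (mul_ne_zero hpi hpi)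
  rw [div_self (mul_ne_zero hpi hpi)] at key
  refine key.congr' ?_
  filter_upwards [eventually_gt_atTop 0] with t ht
  have ht' : (t : ℝ) ≠ 0 := by positivity
  have h := choose_mul_rpow_div_eq_stirlingSeq (p * t) (q * t) (by positivity) (by positivity)
  have hratio : ((p * t : ℕ) : ℝ) / ((q * t : ℕ) : ℝ) = p / q := by
    push_cast
    exact mul_div_mul_right _ _ ht'
  rw [hratio, ← add_mul, Nat.cast_mul q t, ← mul_assoc (2 * Real.pi)] at h
  exact h.symm
end
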